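/- (Local a posteriori state-space error bound, conservative LSPG.) Under the stated hypotheses, with ζ_P := ‖Σ_P⁻¹ U_Pᵀ C̄‖ and E := Ψ (ΦᵀΨ)⁻¹ − Φ, the state-space error satisfies ‖e^n‖ ≤ Σ_{ℓ=0}^k ε_ℓ ‖(I_N − P_P) f(x_0 + Φ x̂^{n−ℓ}, t^{n−ℓ})‖ + ζ_P Σ_{ℓ=0}^k ε_ℓ ‖(I_N − P_Pᵀ P_P) f(x_0 + Φ x̂^{n−ℓ}, t^{n−ℓ})‖ + (ζ_P / h) ‖E‖ Σ_{ℓ=0}^k |α_ℓ| ‖x̂^{n−ℓ}‖ + Σ_{ℓ=1}^k γ_ℓ ‖e^{n−ℓ}‖. -/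

import Mathlib

open Matrix Finset

noncomputable def euclNorm {n : ℕ} (v : Fin n → ℝ) : ℝ := Real.sqrt (∑ i, v i ^ 2)

noncomputable def matNorm {m n : ℕ} (M : Matrix (Fin m) (Fin n) ℝ) : ℝ :=
  ‖LinearMap.toContinuousLinearMap (Matrix.toEuclideanLin M)‖

theorem euclNorm_eq_norm {n : ℕ} (v : Fin n → ℝ) : euclNorm v = ‖WithLp.toLp 2 v‖ := by
  simp [euclNorm, EuclideanSpace.norm_eq]

theorem euclNorm_add_le {n : ℕ} (v w : Fin n → ℝ) :
    euclNorm (v + w) ≤ euclNorm v + euclNorm w := by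
  simp only [euclNorm_eq_norm, WithLp.toLp_add]
  exact norm_add_le _ _

theorem euclNorm_smul {n : ℕ} (a : ℝ) (v : Fin n → ℝ) :
    euclNorm (a • v) = |a| * euclNorm v := by
  simp only [euclNorm_eq_norm, WithLp.toLp_smul, norm_smul, Real.norm_eq_abs]

theorem euclNorm_neg {n : ℕ} (v : Fin n → ℝ) : euclNorm (-v) = euclNorm v := by
  simp [euclNorm]

theorem euclNorm_sub_le {n : ℕ} (v w : Fin n → ℝ) :
    euclNorm (v - w) ≤ euclNorm v + euclNorm w := by
  rw [sub_eq_add_neg, ← euclNorm_neg w]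
  exact euclNorm_add_le _ _

theorem euclNorm_sum_le {n : ℕ} {ι : Type*} (s : Finset ι) (v : ι → Fin n → ℝ) :
    euclNorm (∑ i ∈ s, v i) ≤ ∑ i ∈ s, euclNorm (v i) := by
  simp only [euclNorm_eq_norm, WithLp.toLp_sum]
  exact norm_sum_le _ _

theorem matNorm_nonneg {m n : ℕ} (M : Matrix (Fin m) (Fin n) ℝ) : 0 ≤ matNorm M :=
  norm_nonneg _

theorem euclNorm_mulVec_le {m n : ℕ} (M : Matrix (Fin m) (Fin n) ℝ) (v : Fin n → ℝ) :
    euclNorm (M *ᵥ v) ≤ matNorm M * euclNorm v := by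
  simp only [euclNorm_eq_norm]
  exact (LinearMap.toContinuousLinearMap (Matrix.toEuclideanLin M)).le_opNorm (WithLp.toLp 2 v)

/-- Matrices with orthonormal columns preserve the Euclidean norm. -/
theorem euclNorm_mulVec_of_transpose_mul_self {m n : ℕ} {M : Matrix (Fin m) (Fin n) ℝ}
    (hM : Mᵀ * M = 1) (v : Fin n → ℝ) : euclNorm (M *ᵥ v) = euclNorm v := by
  have hdot : (M *ᵥ v) ⬝ᵥ (M *ᵥ v) = v ⬝ᵥ v := by
    rw [Matrix.dotProduct_mulVec, ← Matrix.mulVec_transpose, Matrix.mulVec_mulVec, hM,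
      Matrix.one_mulVec]
  simp only [dotProduct, ← sq] at hdot
  rw [euclNorm, euclNorm, hdot]

/-- Bound on the oblique projection `Φ A r` of a vector `r` with `C r = 0`, where `A` is a left
inverse of `Φ`, in terms of a singular value decomposition of `C Aᵀ`. -/
theorem euclNorm_mulVec_le_of_mulVec_eq_zero {N Nb p s : ℕ}
    {A : Matrix (Fin p) (Fin N) ℝ} {C : Matrix (Fin Nb) (Fin N) ℝ}
    {U : Matrix (Fin Nb) (Fin s) ℝ} {S : Matrix (Fin s) (Fin s) ℝ} {V : Matrix (Fin p) (Fin s) ℝ}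
    (hU : Uᵀ * U = 1) (hV : Vᵀ * V = 1) (hS : IsUnit S.det) (hSVD : C * Aᵀ = U * S * Vᵀ)
    {r : Fin N → ℝ} {lam : Fin Nb → ℝ} (hCr : C *ᵥ r = 0) (hAr : A *ᵥ r = (A * Cᵀ) *ᵥ lam) :
    euclNorm (A *ᵥ r) ≤ matNorm (S⁻¹ * Uᵀ * C) * euclNorm ((1 - Aᵀ * A) *ᵥ r) := by
  have hAC : A * Cᵀ = V * (Sᵀ * Uᵀ) := by
    have := congrArg Matrix.transpose hSVD
    simpa [Matrix.transpose_mul, Matrix.mul_assoc] using this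
  have hVA : S⁻¹ * Uᵀ * C * Aᵀ = Vᵀ := by
    calc S⁻¹ * Uᵀ * C * Aᵀ = S⁻¹ * ((Uᵀ * U) * (S * Vᵀ)) := by
          simp only [Matrix.mul_assoc, hSVD]
      _ = Vᵀ := by rw [hU, Matrix.one_mul, ← Matrix.mul_assoc, Matrix.nonsing_inv_mul _ hS,
          Matrix.one_mul]
  have hrange : A *ᵥ r = V *ᵥ (Vᵀ *ᵥ (A *ᵥ r)) := by
    rw [hAr, hAC, Matrix.mulVec_mulVec, Matrix.mulVec_mulVec, Matrix.mul_assoc V Vᵀ,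
      ← Matrix.mul_assoc Vᵀ V, hV, Matrix.one_mul]
  have hcoord : Vᵀ *ᵥ (A *ᵥ r) = -((S⁻¹ * Uᵀ * C) *ᵥ ((1 - Aᵀ * A) *ᵥ r)) := by
    rw [Matrix.sub_mulVec, Matrix.one_mulVec, Matrix.mulVec_sub,
      ← Matrix.mulVec_mulVec r _ C, hCr, Matrix.mulVec_zero, zero_sub, neg_neg,
      ← Matrix.mulVec_mulVec r Aᵀ A, Matrix.mulVec_mulVec _ _ Aᵀ, hVA]
  rw [hrange, euclNorm_mulVec_of_transpose_mul_self hV, hcoord, euclNorm_neg]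
  exact euclNorm_mulVec_le _ _

/-- Lipschitz perturbation bound for one step of a linear multistep scheme. -/
theorem euclNorm_multistep_sub_le {N : ℕ} {f : (Fin N → ℝ) → ℝ → (Fin N → ℝ)} {κ : ℝ}
    (hLip : ∀ x y s, euclNorm (f x s - f y s) ≤ κ * euclNorm (x - y))
    (a b s : ℝ) (x0 x y : Fin N → ℝ) :
    euclNorm ((b • f (x0 + x) s - a • x) - (b • f (x0 + y) s - a • y))
      ≤ (|a| + |b| * κ) * euclNorm (x - y) := by
  have hsplit : (b • f (x0 + x) s - a • x) - (b • f (x0 + y) s - a • y)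
      = b • (f (x0 + x) s - f (x0 + y) s) - a • (x - y) := by
    simp only [smul_sub]; abel
  rw [hsplit]
  refine (euclNorm_sub_le _ _).trans ?_
  rw [euclNorm_smul, euclNorm_smul]
  have hL := hLip (x0 + x) (x0 + y) s
  rw [add_sub_add_left_eq_sub] at hL
  nlinarith [mul_le_mul_of_nonneg_left hL (abs_nonneg b)]

/-- Local a posteriori state-space error bound for conservative LSPG
projection. -/
theorem conservative_lspg_state_error_bound
    (N Nb p k : ℕ) (hN : 0 < N) (hNb : 0 < Nb) (hp : 0 < p) (hk : 1 ≤ k)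
    (Φ : Matrix (Fin N) (Fin p) ℝ) (hΦ : Φᵀ * Φ = 1)
    (C : Matrix (Fin Nb) (Fin N) ℝ)
    (Δt : ℝ) (hΔt : 0 < Δt)
    (α β : ℕ → ℝ) (hα0 : α 0 ≠ 0)
    (t : ℕ → ℝ) (x0 : Fin N → ℝ)
    (f : (Fin N → ℝ) → ℝ → (Fin N → ℝ))
    (κ : ℝ) (hκ : 0 < κ)
    (hLip : ∀ x y s, euclNorm (f x s - f y s) ≤ κ * euclNorm (x - y))
    (h : ℝ) (hdef : h = |α 0| - |β 0| * κ * Δt)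
    (hstab : |β 0| * κ * Δt < |α 0|)
    (ε γ : ℕ → ℝ)
    (hε : ∀ ℓ, ε ℓ = |β ℓ| * Δt / h)
    (hγ : ∀ ℓ, γ ℓ = (|α ℓ| + |β ℓ| * κ * Δt) / h)
    (rhat : (ℕ → Fin N → ℝ) → (Fin N → ℝ))
    (hrhat : ∀ y, rhat y = ∑ ℓ ∈ Finset.Icc 1 k,
      ((β ℓ * Δt) • f (x0 + y ℓ) (t ℓ) - α ℓ • y ℓ))
    (x : ℕ → Fin N → ℝ)
    (hFOM : α 0 • x 0 = (β 0 * Δt) • f (x0 + x 0) (t 0) + rhat x)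
    (Ψ : Matrix (Fin N) (Fin p) ℝ) (hinv : IsUnit (Ψᵀ * Φ).det)
    (xh : ℕ → Fin p → ℝ) (lam : Fin Nb → ℝ)
    (hROM : α 0 • xh 0 = (β 0 * Δt) • ((Ψᵀ * Φ)⁻¹ * Ψᵀ).mulVec
        (f (x0 + Φ.mulVec (xh 0)) (t 0))
      + ((Ψᵀ * Φ)⁻¹ * Ψᵀ).mulVec (rhat (fun ℓ => Φ.mulVec (xh ℓ)))
      - ((Ψᵀ * Φ)⁻¹ * Ψᵀ * Cᵀ).mulVec lam)
    (hcons : α 0 • (C * Φ).mulVec (xh 0)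
      = (β 0 * Δt) • C.mulVec (f (x0 + Φ.mulVec (xh 0)) (t 0))
        + C.mulVec (rhat (fun ℓ => Φ.mulVec (xh ℓ))))
    (s : ℕ) (hs : s = (C * Ψ * (Φᵀ * Ψ)⁻¹).rank)
    (U : Matrix (Fin Nb) (Fin s) ℝ) (Sp : Matrix (Fin s) (Fin s) ℝ)
    (V : Matrix (Fin p) (Fin s) ℝ)
    (hU : Uᵀ * U = 1) (hV : Vᵀ * V = 1)
    (hSdiag : ∀ i j : Fin s, i ≠ j → Sp i j = 0)
    (hSpos : ∀ i : Fin s, 0 < Sp i i)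
    (hSVD : C * Ψ * (Φᵀ * Ψ)⁻¹ = U * Sp * Vᵀ)
    (Vb : Matrix (Fin N) (Fin s) ℝ) (hVb : Vb = Φ * V)
    (Z : Matrix (Fin N) (Fin (N - s)) ℝ)
    (hZ : Zᵀ * Z = 1) (hZV : Zᵀ * Vb = 0)
    (hdecomp : Vb * Vbᵀ + Z * Zᵀ = 1)
    (e : ℕ → Fin N → ℝ) (he : ∀ m, e m = x m - Φ.mulVec (xh m))
    (ζ : ℝ) (hζ : ζ = matNorm (Sp⁻¹ * Uᵀ * C))
    (E : Matrix (Fin N) (Fin p) ℝ) (hE : E = Ψ * (Φᵀ * Ψ)⁻¹ - Φ)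
    (P : Matrix (Fin N) (Fin N) ℝ) (hP : P = Φ * (Ψᵀ * Φ)⁻¹ * Ψᵀ) :
    euclNorm (e 0) ≤
      (∑ ℓ ∈ Finset.range (k + 1),
        ε ℓ * euclNorm ((1 - P).mulVec (f (x0 + Φ.mulVec (xh ℓ)) (t ℓ))))
      + ζ * (∑ ℓ ∈ Finset.range (k + 1),
          ε ℓ * euclNorm ((1 - Pᵀ * P).mulVec (f (x0 + Φ.mulVec (xh ℓ)) (t ℓ))))
      + (ζ / h) * matNorm E *
          (∑ ℓ ∈ Finset.range (k + 1), |α ℓ| * euclNorm (xh ℓ))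
      + ∑ ℓ ∈ Finset.Icc 1 k, γ ℓ * euclNorm (e ℓ) := by
  have hh : 0 < h := by rw [hdef]; linarith
  set A : Matrix (Fin p) (Fin N) ℝ := (Ψᵀ * Φ)⁻¹ * Ψᵀ with hA
  set F : ℕ → Fin N → ℝ := fun ℓ => f (x0 + Φ *ᵥ xh ℓ) (t ℓ) with hF
  have hAΦ : A * Φ = 1 := by
    rw [hA, Matrix.mul_assoc, Matrix.nonsing_inv_mul _ hinv]
  have hAT : Aᵀ = Ψ * (Φᵀ * Ψ)⁻¹ := by
    rw [hA, Matrix.transpose_mul, Matrix.transpose_nonsing_inv, Matrix.transpose_mul,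
      Matrix.transpose_transpose]
  have hPA : P = Φ * A := by rw [hP, hA, Matrix.mul_assoc]
  have hPP : Pᵀ * P = Aᵀ * A := by
    rw [hPA, Matrix.transpose_mul, Matrix.mul_assoc, ← Matrix.mul_assoc Φᵀ, hΦ, Matrix.one_mul]
  set r : Fin N → ℝ := ∑ ℓ ∈ Finset.range (k + 1),
    ((β ℓ * Δt) • F ℓ - α ℓ • (Φ *ᵥ xh ℓ)) with hr
  have hsum : ∀ {M : Type} [AddCommMonoid M] (g : ℕ → M),
      ∑ ℓ ∈ Finset.range (k + 1), g ℓ = g 0 + ∑ ℓ ∈ Finset.Icc 1 k, g ℓ := by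
    intro M _ g
    rw [Finset.range_eq_Ico, Finset.sum_eq_sum_Ico_succ_bot (Nat.succ_pos k)]
    rfl
  have hr' : r = (β 0 * Δt) • F 0 - α 0 • (Φ *ᵥ xh 0) + rhat (fun ℓ => Φ *ᵥ xh ℓ) := by
    rw [hr, hsum, hrhat]
  have hCr : C *ᵥ r = 0 := by
    rw [hr', Matrix.mulVec_add, Matrix.mulVec_sub, Matrix.mulVec_smul, Matrix.mulVec_smul,
      Matrix.mulVec_mulVec, hcons]
    abel
  have hAr : A *ᵥ r = (A * Cᵀ) *ᵥ lam := by
    rw [hr', Matrix.mulVec_add, Matrix.mulVec_sub, Matrix.mulVec_smul, Matrix.mulVec_smul,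
      Matrix.mulVec_mulVec, hAΦ, Matrix.one_mulVec, hROM]
    abel
  have hSdet : IsUnit Sp.det := by
    have hdiag : Sp = Matrix.diagonal fun i => Sp i i := by
      ext i j
      by_cases hij : i = j
      · subst hij; simp
      · rw [hSdiag i j hij, Matrix.diagonal_apply_ne _ hij]
    rw [hdiag, Matrix.det_diagonal]
    exact (Finset.prod_pos fun i _ => hSpos i).ne'.isUnit
  have hproj : euclNorm (A *ᵥ r) ≤ ζ * euclNorm ((1 - Aᵀ * A) *ᵥ r) := by
    rw [hζ]
    refine euclNorm_mulVec_le_of_mulVec_eq_zero hU hV hSdet ?_ hCr hAr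
    rw [hAT, ← Matrix.mul_assoc, hSVD]
  have hζ0 : 0 ≤ ζ := hζ ▸ matNorm_nonneg _
  have habs : ∀ ℓ, |β ℓ * Δt| = |β ℓ| * Δt := fun ℓ => by rw [abs_mul, abs_of_pos hΔt]
  have hcomp : euclNorm ((1 - P) *ᵥ r)
      ≤ ∑ ℓ ∈ Finset.range (k + 1), |β ℓ| * Δt * euclNorm ((1 - P) *ᵥ F ℓ) := by
    rw [hr, Matrix.mulVec_sum]
    refine (euclNorm_sum_le _ _).trans (Finset.sum_le_sum fun ℓ _ => le_of_eq ?_)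
    have hker : (1 - P) * Φ = 0 := by
      rw [hPA, Matrix.sub_mul, Matrix.mul_assoc, hAΦ, Matrix.one_mul, Matrix.mul_one, sub_self]
    rw [Matrix.mulVec_sub, Matrix.mulVec_smul, Matrix.mulVec_smul, Matrix.mulVec_mulVec _ _ Φ,
      hker, Matrix.zero_mulVec, smul_zero, sub_zero, euclNorm_smul, habs]
  have hnormal : euclNorm ((1 - Aᵀ * A) *ᵥ r)
      ≤ (∑ ℓ ∈ Finset.range (k + 1), |β ℓ| * Δt * euclNorm ((1 - Aᵀ * A) *ᵥ F ℓ))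
        + matNorm E * ∑ ℓ ∈ Finset.range (k + 1), |α ℓ| * euclNorm (xh ℓ) := by
    rw [hr, Matrix.mulVec_sum, Finset.mul_sum, ← Finset.sum_add_distrib]
    refine (euclNorm_sum_le _ _).trans (Finset.sum_le_sum fun ℓ _ => ?_)
    have hEA : (1 - Aᵀ * A) * Φ = -E := by
      rw [hE, ← hAT, Matrix.sub_mul, Matrix.mul_assoc, hAΦ, Matrix.one_mul, Matrix.mul_one,
        neg_sub]
    rw [Matrix.mulVec_sub, Matrix.mulVec_smul, Matrix.mulVec_smul, Matrix.mulVec_mulVec _ _ Φ,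
      hEA, Matrix.neg_mulVec]
    refine (euclNorm_sub_le _ _).trans ?_
    rw [euclNorm_smul, euclNorm_smul, habs, euclNorm_neg]
    have := mul_le_mul_of_nonneg_left (euclNorm_mulVec_le E (xh ℓ)) (abs_nonneg (α ℓ))
    linarith
  have hres : euclNorm r ≤ euclNorm ((1 - P) *ᵥ r) + euclNorm (A *ᵥ r) := by
    have hsplit : r = (1 - P) *ᵥ r + Φ *ᵥ (A *ᵥ r) := by
      rw [Matrix.mulVec_mulVec, ← hPA, ← Matrix.add_mulVec, sub_add_cancel, Matrix.one_mulVec]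
    calc euclNorm r = euclNorm ((1 - P) *ᵥ r + Φ *ᵥ (A *ᵥ r)) := congrArg _ hsplit
      _ ≤ _ := euclNorm_add_le _ _
      _ = _ := by rw [euclNorm_mulVec_of_transpose_mul_self hΦ]
  have herr : α 0 • e 0 = (β 0 * Δt) • (f (x0 + x 0) (t 0) - F 0)
      + ((∑ ℓ ∈ Finset.Icc 1 k, (((β ℓ * Δt) • f (x0 + x ℓ) (t ℓ) - α ℓ • x ℓ)
        - ((β ℓ * Δt) • F ℓ - α ℓ • (Φ *ᵥ xh ℓ)))) + r) := by
    rw [Finset.sum_sub_distrib, ← hrhat, ← hrhat (fun ℓ => Φ *ᵥ xh ℓ), hr', he, smul_sub, hFOM,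
      smul_sub]
    abel
  have hmain : h * euclNorm (e 0) ≤
      (∑ ℓ ∈ Finset.Icc 1 k, (|α ℓ| + |β ℓ| * κ * Δt) * euclNorm (e ℓ)) + euclNorm r := by
    have h0 : |α 0| * euclNorm (e 0) ≤ |β 0| * Δt * (κ * euclNorm (e 0))
        + ((∑ ℓ ∈ Finset.Icc 1 k, (|α ℓ| + |β ℓ| * κ * Δt) * euclNorm (e ℓ)) + euclNorm r) := by
      rw [← euclNorm_smul, herr]
      refine (euclNorm_add_le _ _).trans (add_le_add ?_ ((euclNorm_add_le _ _).trans
        (add_le_add_left ((euclNorm_sum_le _ _).trans (Finset.sum_le_sum fun ℓ _ => ?_)) _)))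
      · rw [euclNorm_smul, habs]
        refine mul_le_mul_of_nonneg_left ?_ (by positivity)
        have hL := hLip (x0 + x 0) (x0 + Φ *ᵥ xh 0) (t 0)
        rwa [add_sub_add_left_eq_sub, ← he] at hL
      · have hL := euclNorm_multistep_sub_le hLip (α ℓ) (β ℓ * Δt) (t ℓ) x0 (x ℓ) (Φ *ᵥ xh ℓ)
        rwa [habs, ← he, mul_right_comm] at hL
    rw [hdef]
    linarith
  have hbound := mul_le_mul_of_nonneg_left hnormal hζ0
  rw [hPP, ← mul_le_mul_iff_right₀ hh]
  refine (hmain.trans (add_le_add_right (hres.trans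
    (add_le_add hcomp (hproj.trans hbound))) _)).trans (le_of_eq ?_)
  have hhε : ∀ ℓ, |β ℓ| * Δt = h * ε ℓ := fun ℓ => by rw [hε, mul_div_cancel₀ _ hh.ne']
  have hhγ : ∀ ℓ, |α ℓ| + |β ℓ| * κ * Δt = h * γ ℓ := fun ℓ => by
    rw [hγ, mul_div_cancel₀ _ hh.ne']
  simp only [hhε, hhγ, hF]
  simp only [mul_assoc h, ← Finset.mul_sum]
  field_simp
  ring
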